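/- Let p be a prime and G a finite p-group. If p > 3, then G has property L_p if and only if G is trivial. If p = 3, then G has property L_3 if and only if G is trivial or G is isomorphic to ℤ/3ℤ. -/

import Mathlib

/-- The natural reduction ring homomorphism `W₂(k) → k` from length-two `p`-typical
Witt vectors to `k`, given by the zeroth coefficient. -/
noncomputable def wittReduce (p : ℕ) [Fact p.Prime] (k : Type*) [CommRing k] :
    TruncatedWittVector p 2 k →+* k :=
  RingHom.liftOfRightInverse (WittVector.truncate 2) TruncatedWittVector.out
    TruncatedWittVector.truncateFun_out
    ⟨WittVector.constantCoeff, fun x hx => by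
      rw [WittVector.mem_ker_truncate] at hx
      simpa [RingHom.mem_ker] using hx 0 (by norm_num)⟩

/-- A finite group `G` has property `L_p` if every homomorphism `G → GL_n(k)`, for `k` a
finite field of characteristic `p`, lifts to `GL_n(W₂(k))`. -/
def HasLp (p : ℕ) [Fact p.Prime] (G : Type*) [Group G] : Prop :=
  ∀ (n : ℕ), 1 ≤ n → ∀ (k : Type) [Field k] [Fintype k] [CharP k p],
    ∀ f : G →* GL (Fin n) k,
      ∃ g : G →* GL (Fin n) (TruncatedWittVector p 2 k),
        (Matrix.GeneralLinearGroup.map (wittReduce p k)).comp g = f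

/-- A group has property `L` if it has property `L_p` for every prime `p`. -/
def HasL (G : Type*) [Group G] : Prop :=
  ∀ (p : ℕ) [Fact p.Prime], HasLp p G

/-- A ring homomorphism behaving like `W₂(k) → k` for `k` perfect of characteristic `p`: it is
surjective, and its kernel is both the set of multiples of `p` and the annihilator of `p`. -/
structure IsLengthTwo (p : ℕ) {S T : Type*} [Ring S] [Ring T] (π : S →+* T) : Prop where
  surjective : Function.Surjective π
  map_eq_zero_iff : ∀ x, π x = 0 ↔ ∃ y, x = p * y
  natCast_mul_eq_zero_iff : ∀ x, (p : S) * x = 0 ↔ π x = 0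

lemma wittReduce_truncate (p : ℕ) [Fact p.Prime] (k : Type*) [CommRing k] (x : WittVector p k) :
    wittReduce p k (WittVector.truncate 2 x) = x.coeff 0 :=
  RingHom.liftOfRightInverse_comp_apply _ _ _ _ x

lemma isLengthTwo_wittReduce (p : ℕ) [Fact p.Prime] (k : Type*) [Field k] [Finite k]
    [CharP k p] : IsLengthTwo p (wittReduce p k) where
  surjective x := ⟨WittVector.truncate 2 (WittVector.teichmuller p x), by
    rw [wittReduce_truncate, WittVector.teichmuller_coeff_zero]⟩
  map_eq_zero_iff x := by
    obtain ⟨x, rfl⟩ := WittVector.truncate_surjective p 2 k x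
    rw [wittReduce_truncate]
    constructor
    · intro h
      have hx := WittVector.verschiebung_shift x 0 (by simpa using h)
      obtain ⟨z, hz⟩ := (WittVector.frobenius_bijective p k).2 (x.shift 1)
      refine ⟨WittVector.truncate 2 z, ?_⟩
      rw [← map_natCast (WittVector.truncate (p := p) (R := k) 2), ← map_mul, mul_comm,
        ← WittVector.verschiebung_frobenius, hz]
      exact congrArg (WittVector.truncate 2) ((show x = x.shift 0 by ext; simp [WittVector.shift_coeff]).trans hx.symm)
    · rintro ⟨y, hy⟩
      have := congrArg (wittReduce p k) hy
      rwa [wittReduce_truncate, map_mul, map_natCast, CharP.cast_eq_zero, zero_mul] at this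
  natCast_mul_eq_zero_iff x := by
    obtain ⟨x, rfl⟩ := WittVector.truncate_surjective p 2 k x
    rw [wittReduce_truncate, ← map_natCast (WittVector.truncate (p := p) (R := k) 2), ← map_mul,
      mul_comm, ← RingHom.mem_ker, WittVector.mem_ker_truncate]
    constructor
    · intro h
      have := h 1 (by norm_num)
      rw [WittVector.mul_charP_coeff_succ] at this
      exact pow_eq_zero_iff (Nat.Prime.ne_zero Fact.out) |>.1 this
    · intro h i hi
      interval_cases i
      · exact WittVector.mul_charP_coeff_zero x
      · rw [WittVector.mul_charP_coeff_succ, h, zero_pow (Nat.Prime.ne_zero Fact.out)]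

namespace IsLengthTwo

variable {p : ℕ}

section Ring

variable {S T : Type*} [Ring S] [Ring T] {π : S →+* T}

lemma map_natCast_mul (h : IsLengthTwo p π) (x : S) : π (p * x) = 0 :=
  (h.map_eq_zero_iff _).2 ⟨x, rfl⟩

lemma natCast_mul_natCast_mul (h : IsLengthTwo p π) (x : S) : (p : S) * (p * x) = 0 :=
  (h.natCast_mul_eq_zero_iff _).2 (h.map_natCast_mul x)

lemma mul_eq_zero (h : IsLengthTwo p π) {x y : S} (hx : π x = 0) (hy : π y = 0) :
    x * y = 0 := by
  obtain ⟨x, rfl⟩ := (h.map_eq_zero_iff x).1 hx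
  rw [(Nat.cast_commute p x).eq, mul_assoc, (h.natCast_mul_eq_zero_iff y).2 hy, mul_zero]

lemma mapMatrix {n : Type*} [Fintype n] [DecidableEq n] (h : IsLengthTwo p π) :
    IsLengthTwo p (π.mapMatrix (m := n)) where
  surjective X := by
    choose s hs using h.surjective
    exact ⟨X.map s, by ext; simp [hs]⟩
  map_eq_zero_iff X := by
    constructor
    · intro hX
      have hex : ∀ i j, ∃ y, X i j = p * y := fun i j =>
        (h.map_eq_zero_iff _).1 (by simpa using congrFun (congrFun hX i) j)
      choose Y hY using hex
      refine ⟨Matrix.of Y, ?_⟩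
      ext i j
      rw [← nsmul_eq_mul, Matrix.smul_apply, nsmul_eq_mul, hY, Matrix.of_apply]
    · rintro ⟨Y, rfl⟩
      ext i j
      rw [← nsmul_eq_mul, RingHom.mapMatrix_apply, Matrix.map_apply, Matrix.smul_apply,
        nsmul_eq_mul, h.map_natCast_mul, Matrix.zero_apply]
  natCast_mul_eq_zero_iff X := by
    simp only [← nsmul_eq_mul, ← Matrix.ext_iff, Matrix.smul_apply, Matrix.zero_apply,
      RingHom.mapMatrix_apply, Matrix.map_apply]
    simp only [nsmul_eq_mul, h.natCast_mul_eq_zero_iff]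

lemma map_eq_zero_of_one_add_pow_eq_one (h : IsLengthTwo p π) (hp : p.Prime) (hp3 : 3 < p)
    {M : S} (hM : (1 + M) ^ p = 1) (hM2 : π M ^ 2 = 0) : π M = 0 := by
  have h2 : π (M ^ 2) = 0 := by rwa [map_pow]
  have h4 : M ^ 4 = 0 := by
    rw [show 4 = 2 + 2 from rfl, pow_add]
    exact h.mul_eq_zero h2 h2
  rw [← h.natCast_mul_eq_zero_iff]
  rw [add_comm, (Commute.one_right M).add_pow, Finset.sum_eq_add_of_mem 0 1 (by simp)
    (by simp [hp.pos]) zero_ne_one] at hM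
  · simpa [(Nat.cast_commute p M).eq] using hM
  · rintro i hi ⟨hi0, hi1⟩
    rw [one_pow, mul_one]
    obtain hi4 | hi4 := le_or_gt 4 i
    · rw [← Nat.add_sub_cancel' hi4, pow_add, h4, zero_mul, zero_mul]
    · obtain ⟨c, hc⟩ := hp.dvd_choose_self hi0 (by lia)
      rw [hc, Nat.cast_mul, ← mul_assoc, ← (Nat.cast_commute p (M ^ i)).eq,
        (h.natCast_mul_eq_zero_iff _).2, zero_mul]
      rw [← Nat.add_sub_cancel' (show 2 ≤ i by lia), pow_add, map_mul, h2, zero_mul]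

lemma map_pow_three_eq_zero (h : IsLengthTwo 3 π) {M : S} (hM : (1 + M) ^ 9 = 1)
    (hM4 : π M ^ 4 = 0) : π M ^ 3 = 0 := by
  have h4 : π (M ^ 4) = 0 := by rwa [map_pow]
  have h8 : M ^ 8 = 0 := by
    rw [show 8 = 4 + 4 from rfl, pow_add]
    exact h.mul_eq_zero h4 h4
  have h34 : ∀ x, 3 * (M ^ 4 * x) = 0 := fun x => by
    simpa using (h.natCast_mul_eq_zero_iff (M ^ 4 * x)).2 (by rw [map_mul, h4, zero_mul])
  have h9 : ∀ x : S, 9 * x = 0 := fun x => by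
    have := h.natCast_mul_natCast_mul x
    rw [← mul_assoc] at this
    norm_num at this
    exact this
  have key : (1 + M) ^ 9 = 1 + 3 * M ^ 3 + 9 * (M + 4 * M ^ 2 + 9 * M ^ 3 + M ^ 8) +
      3 * (M ^ 4 * (42 + 42 * M + 28 * M ^ 2 + 12 * M ^ 3)) + M ^ 8 * M := by
    noncomm_ring
  rw [key, h9, h34, h8, zero_mul, add_zero, add_zero, add_zero, add_eq_left] at hM
  rw [← map_pow]
  exact (h.natCast_mul_eq_zero_iff _).1 (by simpa using hM)

/-- The relation `YC = XD`, `XC = -X` satisfied by the leading coefficients of a lift of a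
representation of `(ℤ/3)²` on which the augmentation ideal squares to zero. -/
lemma exists_mul_eq_neg (h : IsLengthTwo 3 π) {M N : S} (hM : (1 + M) ^ 3 = 1)
    (hMN : M * N = N * M) (hM2 : π M ^ 2 = 0) (hMN0 : π M * π N = 0) :
    ∃ C D : T, π M * C = -π M ∧ π N * C = π M * D := by
  have h2 : π (M ^ 2) = 0 := by rwa [map_pow]
  obtain ⟨C, hC⟩ := (h.map_eq_zero_iff _).1 h2
  obtain ⟨D, hD⟩ := (h.map_eq_zero_iff (M * N)).1 (by rwa [map_mul])
  have hcomm (x y : S) : x * ((3 : ℕ) * y) = (3 : ℕ) * (x * y) := by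
    rw [← mul_assoc, ← (Nat.cast_commute 3 x).eq, mul_assoc]
  refine ⟨π C, π D, ?_, ?_⟩
  · rw [← sub_eq_zero, sub_neg_eq_add, ← map_mul, ← map_add, ← h.natCast_mul_eq_zero_iff, mul_add,
      ← hcomm, ← hC]
    have key : (1 + M) ^ 3 = 1 + (M * M ^ 2 + (3 : ℕ) * M) + (3 : ℕ) * M ^ 2 := by
      push_cast; noncomm_ring
    rwa [key, (h.natCast_mul_eq_zero_iff _).2 h2, add_zero, add_eq_left] at hM
  · rw [← sub_eq_zero, ← map_mul, ← map_mul, ← map_sub, ← h.natCast_mul_eq_zero_iff, mul_sub,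
      ← hcomm, ← hcomm, ← hC, ← hD, sub_eq_zero, pow_two, ← mul_assoc, ← hMN, mul_assoc, ← hMN]

end Ring

section CommRing

variable {R k : Type*} [CommRing R] [CommRing k] {π : R →+* k}

lemma matrix_mul_eq_zero (h : IsLengthTwo p π) {l m n : Type*} [Fintype m]
    {X : Matrix l m R} {Y : Matrix m n R} (hX : X.map π = 0) (hY : Y.map π = 0) : X * Y = 0 := by
  ext i j
  exact Finset.sum_eq_zero fun a _ => h.mul_eq_zero (congrFun (congrFun hX i) a)
    (congrFun (congrFun hY a) j)

lemma exists_map_eq (h : IsLengthTwo p π) {m n : Type*} (X : Matrix m n k) :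
    ∃ Y : Matrix m n R, Y.map π = X := by
  choose s hs using h.surjective
  exact ⟨X.map s, by ext; simp [hs]⟩

lemma exists_mul_eq_one (h : IsLengthTwo p π) {m n : Type*} [Fintype m] [DecidableEq m]
    [Fintype n] {P₀ : Matrix m n k} {I₀ : Matrix n m k} (hPI : P₀ * I₀ = 1) :
    ∃ (P : Matrix m n R) (I : Matrix n m R), P.map π = P₀ ∧ I.map π = I₀ ∧ P * I = 1 := by
  obtain ⟨P, rfl⟩ := h.exists_map_eq P₀
  obtain ⟨I, rfl⟩ := h.exists_map_eq I₀
  have h0 : (P * I - 1).map π = 0 := by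
    rw [Matrix.map_sub _ (map_sub π), Matrix.map_mul, hPI, Matrix.map_one _ (map_zero π) (map_one π),
      sub_self]
  refine ⟨(1 - (P * I - 1)) * P, I, ?_, rfl, ?_⟩
  · rw [Matrix.map_mul, Matrix.map_sub _ (map_sub π), h0, Matrix.map_one _ (map_zero π) (map_one π),
      sub_zero, Matrix.one_mul]
  · have := h.matrix_mul_eq_zero h0 h0
    rw [Matrix.mul_assoc]
    rw [show P * I = 1 + (P * I - 1) by abel, show (1 - (1 + (P * I - 1) - 1)) * (1 + (P * I - 1)) =
      1 - (P * I - 1) * (P * I - 1) by noncomm_ring, this, sub_zero]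

lemma one_sub_mul_one_sub {m n : Type*} [Fintype m] [DecidableEq m] [Fintype n] [DecidableEq n]
    {P : Matrix m n R} {I : Matrix n m R} (h : P * I = 1) :
    (1 - I * P) * (1 - I * P) = 1 - I * P := by
  refine IsIdempotentElem.one_sub (a := I * P) ?_
  rw [IsIdempotentElem, Matrix.mul_assoc, ← Matrix.mul_assoc P, h, Matrix.one_mul]

lemma map_one_sub_mul {m n : Type*} [Fintype m] [Fintype n] [DecidableEq n]
    (P : Matrix m n R) (I : Matrix n m R) :
    (1 - I * P).map π = 1 - I.map π * P.map π := by
  rw [Matrix.map_sub _ (map_sub π), Matrix.map_mul, Matrix.map_one _ (map_zero π) (map_one π)]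

/-- A direct summand of a liftable representation is liftable. -/
lemma exists_lift_of_retract (h : IsLengthTwo p π) {H : Type*} [Group H] {m n : Type*}
    [Fintype m] [DecidableEq m] [Fintype n] [DecidableEq n] (f : H →* GL m k) (g : H →* GL n R)
    (P₀ : Matrix m n k) (I₀ : Matrix n m k) (hPI : P₀ * I₀ = 1)
    (hP : ∀ x, P₀ * ((g x).1.map π) = (f x).1 * P₀)
    (hI : ∀ x, ((g x).1.map π) * I₀ = I₀ * (f x).1) :
    ∃ f' : H →* GL m R, (Matrix.GeneralLinearGroup.map π).comp f' = f := by
  obtain ⟨P, I, rfl, rfl, h1⟩ := h.exists_mul_eq_one hPI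
  have hE : (1 - I * P) * (1 - I * P) = 1 - I * P := one_sub_mul_one_sub h1
  have hmul (x y : H) : P * (g x).1 * (1 - I * P) * ((g y).1 * I) = 0 := by
    rw [← hE, ← Matrix.mul_assoc _ (1 - I * P), Matrix.mul_assoc _ (1 - I * P) (_ * I)]
    apply h.matrix_mul_eq_zero
    · rw [Matrix.map_mul, Matrix.map_mul, hP, map_one_sub_mul, Matrix.mul_sub, Matrix.mul_one,
        Matrix.mul_assoc, ← Matrix.mul_assoc _ _ (P.map π), hPI, Matrix.one_mul, sub_self]
    · rw [Matrix.map_mul, Matrix.map_mul, hI, map_one_sub_mul, Matrix.sub_mul, Matrix.one_mul,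
        Matrix.mul_assoc, ← Matrix.mul_assoc (P.map π), hPI, Matrix.one_mul, sub_self]
  let F : H →* Matrix m m R :=
    { toFun x := P * (g x).1 * I
      map_one' := by simp [h1]
      map_mul' x y := by
        rw [← sub_eq_zero, ← hmul x y]
        simp only [map_mul, Units.val_mul, Matrix.mul_sub, Matrix.sub_mul, Matrix.mul_one,
          Matrix.mul_assoc] }
  refine ⟨F.toHomUnits, ?_⟩
  ext x i j
  have : (P * (g x).1 * I).map π = (f x).1 := by
    rw [Matrix.map_mul, Matrix.map_mul, hP, Matrix.mul_assoc, hPI, Matrix.mul_one]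
  exact congrFun (congrFun this i) j

/-- Liftability of a matrix of finite order is invariant under conjugation. -/
lemma exists_pow_eq_one_map_eq (h : IsLengthTwo p π) {m n : Type*} [Fintype m] [DecidableEq m]
    [Fintype n] [DecidableEq n] {A : Matrix m m k} {Z : Matrix n n R} {d : ℕ} (hZ : Z ^ d = 1)
    {P₀ : Matrix m n k} {I₀ : Matrix n m k} (hPI : P₀ * I₀ = 1) (hIP : I₀ * P₀ = 1)
    (hA : P₀ * Z.map π * I₀ = A) : ∃ B : Matrix m m R, B ^ d = 1 ∧ B.map π = A := by
  obtain ⟨P, I, rfl, rfl, h1⟩ := h.exists_mul_eq_one hPI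
  have h2 : I * P = 1 := by
    have h0 : (1 - I * P).map π = 0 := by rw [map_one_sub_mul, hIP, sub_self]
    have := h.matrix_mul_eq_zero h0 h0
    rw [one_sub_mul_one_sub h1, sub_eq_zero] at this
    exact this.symm
  have hpow (j : ℕ) : (P * Z * I) ^ j = P * Z ^ j * I := by
    induction j with
    | zero => simp [h1]
    | succ j ih =>
      rw [pow_succ, pow_succ, ih, Matrix.mul_assoc _ I, ← Matrix.mul_assoc I, ← Matrix.mul_assoc I,
        h2, Matrix.one_mul]
      simp only [Matrix.mul_assoc]
  refine ⟨P * Z * I, ?_, ?_⟩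
  · rw [hpow, hZ, Matrix.mul_one, h1]
  · rw [Matrix.map_mul, Matrix.map_mul, hA]

end CommRing

end IsLengthTwo

lemma HasLp.of_injective {p : ℕ} [Fact p.Prime] {G H : Type*} [Group G] [Finite G] [Group H]
    (hG : HasLp p G) (φ : H →* G) (hφ : Function.Injective φ) : HasLp p H := by
  intro n hn k _ _ _ f
  let ρ : Representation k H (Fin n → k) :=
    (Matrix.toLinAlgEquiv' (R := k) (n := Fin n)).toMonoidHom.comp ((Units.coeHom _).comp f)
  let W := Representation.coindV φ ρ
  let proj : W →ₗ[k] (Fin n → k) := (LinearMap.proj 1).comp W.subtype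
  have hproj (w : W) : proj w = w.1 1 := rfl
  let incl : (Fin n → k) →ₗ[k] W :=
    { toFun v := ⟨Function.extend φ (fun x => ρ x v) 0, fun x g => by
        by_cases hg : ∃ y, φ y = g
        · obtain ⟨y, rfl⟩ := hg
          rw [← map_mul, hφ.extend_apply, hφ.extend_apply, map_mul]
          rfl
        · rw [Function.extend_apply' _ _ _ hg, Function.extend_apply']
          · simp
          · rintro ⟨y, hy⟩
            exact hg ⟨x⁻¹ * y, by simp [hy]⟩⟩
      map_add' v w := by
        ext1
        simp only [map_add]
        refine Eq.trans ?_ (Function.extend_add φ (fun x => ρ x v) (fun x => ρ x w) 0 0)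
        rw [add_zero]
        rfl
      map_smul' c v := by
        ext1
        simp only [map_smul]
        refine Eq.trans ?_ (Function.extend_smul c φ (fun x => ρ x v) 0)
        rw [smul_zero]
        rfl }
  have hincl (v g) : (incl v).1 g = Function.extend φ (fun x => ρ x v) 0 g := rfl
  let b := Module.finBasis k W
  let e := Pi.basisFun k (Fin n)
  let F : G →* GL (Fin (Module.finrank k W)) k :=
    ((LinearMap.toMatrixAlgEquiv b).toMonoidHom.comp (Representation.coind φ ρ)).toHomUnits
  have hF (g) : (F g).1 = LinearMap.toMatrix b b (Representation.coind φ ρ g) := rfl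
  have hf (x) : (f x).1 = LinearMap.toMatrix e e (ρ x) := by
    rw [LinearMap.toMatrix_eq_toMatrix', ← LinearMap.toMatrix'_toLin' (f x).1]
    rfl
  have hid : proj ∘ₗ incl = LinearMap.id := by
    refine LinearMap.ext fun v => ?_
    rw [LinearMap.comp_apply, hproj, hincl, ← map_one φ, hφ.extend_apply, map_one]
    rfl
  have hpos : 1 ≤ Module.finrank k W := by
    have := LinearMap.finrank_le_finrank_of_injective
      (LinearMap.injective_of_comp_eq_id incl proj hid)
    rw [Module.finrank_fin_fun] at this
    exact hn.trans this
  obtain ⟨g, hg⟩ := hG _ hpos k F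
  have hg' (x) : (g x).1.map (wittReduce p k) = (F x).1 := congrArg Units.val (DFunLike.congr_fun hg x)
  refine (isLengthTwo_wittReduce p k).exists_lift_of_retract f (g.comp φ)
    (LinearMap.toMatrix b e proj) (LinearMap.toMatrix e b incl) ?_ (fun x => ?_) fun x => ?_
  · rw [← LinearMap.toMatrix_comp, hid, LinearMap.toMatrix_id]
  · rw [MonoidHom.comp_apply, hg', hF, hf, ← LinearMap.toMatrix_comp, ← LinearMap.toMatrix_comp]
    congr 1
    refine LinearMap.ext fun w => ?_
    have := w.2 x 1
    rw [mul_one] at this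
    change w.1 (1 * φ x) = ρ x (w.1 1)
    rw [one_mul, this]
  · rw [MonoidHom.comp_apply, hg', hF, hf, ← LinearMap.toMatrix_comp, ← LinearMap.toMatrix_comp]
    congr 1
    refine LinearMap.ext fun v => Subtype.ext (funext fun y => ?_)
    change (incl v).1 (y * φ x) = (incl (ρ x v)).1 y
    rw [hincl, hincl]
    by_cases hy : ∃ z, φ z = y
    · obtain ⟨z, rfl⟩ := hy
      rw [← map_mul, hφ.extend_apply, hφ.extend_apply, map_mul]
      rfl
    · rw [Function.extend_apply' _ _ _ hy, Function.extend_apply']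
      · rfl
      · rintro ⟨z, hz⟩
        exact hy ⟨z * x⁻¹, by simp [hz]⟩

section Nonliftable

/-- The unipotent unit `1 + N`, for `N ^ q = 0` with `q` a power of the characteristic. -/
lemma exists_units_eq_one_add {T : Type*} [Ring T] (p : ℕ) [Fact p.Prime] [CharP T p] (r : ℕ)
    {N : T} (hN : N ^ p ^ r = 0) : ∃ u : Tˣ, u.1 = 1 + N ∧ u ^ p ^ r = 1 := by
  have h : (1 + N) ^ p ^ r = 1 := by
    rw [add_pow_char_pow_of_commute _ _ (Commute.one_left N), hN, one_pow, add_zero]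
  exact ⟨Units.ofPowEqOne _ _ h (pow_ne_zero r (Nat.Prime.ne_zero Fact.out)), rfl,
    Units.pow_ofPowEqOne h _⟩

variable {G : Type*} [Group G]

/-- The cyclic group generated by `x` maps to any group containing an element of order dividing
that of `x`. -/
lemma exists_monoidHom_zpowers {G' : Type*} [Group G'] {m : ℕ} {x : G} (hx : orderOf x = m)
    {u : G'} (hu : u ^ m = 1) :
    ∃ f : Subgroup.zpowers x →* G', f ⟨x, Subgroup.mem_zpowers x⟩ = u ∧
      ∀ y, f y ∈ Subgroup.zpowers u := by
  have hgen : ∀ y : Subgroup.zpowers x, y ∈ Subgroup.zpowers ⟨x, Subgroup.mem_zpowers x⟩ := by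
    rintro ⟨_, i, rfl⟩
    exact ⟨i, rfl⟩
  have hdvd : orderOf u ∣ orderOf (⟨x, Subgroup.mem_zpowers x⟩ : Subgroup.zpowers x) := by
    rw [Subgroup.orderOf_mk, hx]
    exact orderOf_dvd_of_pow_eq_one hu
  refine ⟨monoidHomOfForallMemZpowers hgen hdvd, monoidHomOfForallMemZpowers_apply_gen hgen hdvd,
    fun y => ?_⟩
  obtain ⟨i, rfl⟩ := hgen y
  exact ⟨i, by simp [monoidHomOfForallMemZpowers_apply_gen]⟩

/-- If `x ∈ G` has order `p ^ r` and `G` has property `L_p`, then every unipotent matrix `1 + N`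
over `𝔽_p` of order dividing `p ^ r` lifts to an element of order dividing `p ^ r`. -/
lemma HasLp.exists_lift_one_add {p : ℕ} [Fact p.Prime] [Finite G] (hG : HasLp p G) {r : ℕ} {x : G}
    (hx : orderOf x = p ^ r) {n : ℕ} [NeZero n] {N : Matrix (Fin n) (Fin n) (ZMod p)}
    (hN : N ^ p ^ r = 0) : ∃ M : Matrix (Fin n) (Fin n) (TruncatedWittVector p 2 (ZMod p)),
      (1 + M) ^ p ^ r = 1 ∧ (wittReduce p (ZMod p)).mapMatrix M = N := by
  obtain ⟨u, huN, hu⟩ := exists_units_eq_one_add p r hN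
  obtain ⟨f, hf, -⟩ := exists_monoidHom_zpowers hx hu
  obtain ⟨g, hg⟩ := hG.of_injective (Subgroup.zpowers x).subtype (Subgroup.subtype_injective _) n
    NeZero.one_le (ZMod p) f
  refine ⟨(g ⟨x, Subgroup.mem_zpowers x⟩).1 - 1, ?_, ?_⟩
  · rw [add_sub_cancel, ← Units.val_pow_eq_pow_val, ← map_pow, ← Units.val_one, ← map_one g]
    congr 2
    ext1
    change x ^ p ^ r = 1
    rw [← hx, pow_orderOf_eq_one]
  · rw [map_sub, map_one, sub_eq_iff_eq_add', ← huN, ← hf, ← hg]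
    rfl

lemma not_hasLp_of_three_lt {p : ℕ} [Fact p.Prime] (hp : 3 < p) [Finite G] {x : G}
    (hx : orderOf x = p) : ¬ HasLp p G := by
  intro hG
  let N : Matrix (Fin 2) (Fin 2) (ZMod p) := !![0, 1; 0, 0]
  have hN : N ^ 2 = 0 := by
    ext i j
    fin_cases i <;> fin_cases j <;> simp [N, pow_two]
  obtain ⟨M, hM, hMN⟩ := hG.exists_lift_one_add (r := 1) (by rw [hx, pow_one]) (N := N)
    (by rw [pow_one]; exact pow_eq_zero_of_le (by lia) hN)
  rw [pow_one] at hM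
  have := (isLengthTwo_wittReduce p (ZMod p)).mapMatrix.map_eq_zero_of_one_add_pow_eq_one Fact.out
    hp hM (by rw [hMN, hN])
  rw [hMN] at this
  simpa [N] using congrFun (congrFun this 0) 1

lemma not_hasLp_of_orderOf_eq_nine [Finite G] {x : G} (hx : orderOf x = 9) : ¬ HasLp 3 G := by
  intro hG
  let N : Matrix (Fin 4) (Fin 4) (ZMod 3) := !![0, 1, 0, 0; 0, 0, 1, 0; 0, 0, 0, 1; 0, 0, 0, 0]
  have hN : N ^ 4 = 0 := by decide
  obtain ⟨M, hM, hMN⟩ := hG.exists_lift_one_add (r := 2) hx (N := N)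
    (pow_eq_zero_of_le (by norm_num) hN)
  have := (isLengthTwo_wittReduce 3 (ZMod 3)).mapMatrix.map_pow_three_eq_zero hM (by rw [hMN, hN])
  rw [hMN] at this
  revert this
  decide

lemma not_hasLp_of_commute [Finite G] {x y : G} (hx : orderOf x = 3) (hy : orderOf y = 3)
    (hxy : Commute x y) (hd : Disjoint (Subgroup.zpowers x) (Subgroup.zpowers y)) :
    ¬ HasLp 3 G := by
  intro hG
  let X : Matrix (Fin 3) (Fin 3) (ZMod 3) := !![0, 0, 0; 1, 0, 0; 0, 0, 0]
  let Y : Matrix (Fin 3) (Fin 3) (ZMod 3) := !![0, 0, 0; 0, 0, 0; 1, 0, 0]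
  obtain ⟨u, huX, hu⟩ := exists_units_eq_one_add 3 1 (N := X) (by decide)
  obtain ⟨v, hvY, hv⟩ := exists_units_eq_one_add 3 1 (N := Y) (by decide)
  obtain ⟨α, hα, hαu⟩ := exists_monoidHom_zpowers hx hu
  obtain ⟨β, hβ, hβv⟩ := exists_monoidHom_zpowers hy hv
  have huv : Commute u v := by
    refine Units.ext ?_
    rw [Units.val_mul, Units.val_mul, huX, hvY]
    decide
  have hαβ (a b) : Commute (α a) (β b) := by
    obtain ⟨i, hi⟩ := hαu a
    obtain ⟨j, hj⟩ := hβv b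
    rw [← hi, ← hj]
    exact huv.zpow_zpow i j
  have hcomm (a : Subgroup.zpowers x) (b : Subgroup.zpowers y) :
      Commute ((Subgroup.zpowers x).subtype a) ((Subgroup.zpowers y).subtype b) := by
    obtain ⟨_, i, rfl⟩ := a
    obtain ⟨_, j, rfl⟩ := b
    exact hxy.zpow_zpow i j
  have hinj : Function.Injective (MonoidHom.noncommCoprod _ _ hcomm) := by
    rw [MonoidHom.noncommCoprod_injective]
    exact ⟨Subgroup.subtype_injective _, Subgroup.subtype_injective _, by simpa using hd⟩
  obtain ⟨g, hg⟩ := hG.of_injective _ hinj 3 (by norm_num) (ZMod 3)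
    (MonoidHom.noncommCoprod α β hαβ)
  let a : Subgroup.zpowers x × Subgroup.zpowers y := (⟨x, Subgroup.mem_zpowers x⟩, 1)
  let b : Subgroup.zpowers x × Subgroup.zpowers y := (1, ⟨y, Subgroup.mem_zpowers y⟩)
  have ha : a ^ 3 = 1 := Prod.ext (Subtype.ext (hx ▸ pow_orderOf_eq_one x)) (one_pow 3)
  have hab : Commute a b := (Prod.commute_iff.2 ⟨Commute.one_right _, Commute.one_left _⟩)
  have h := (isLengthTwo_wittReduce 3 (ZMod 3)).mapMatrix (n := Fin 3)
  have hM : (wittReduce 3 (ZMod 3)).mapMatrix ((g a).1 - 1) = X := by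
    rw [map_sub, map_one, sub_eq_iff_eq_add', ← huX, ← hα]
    have := congrArg Units.val (DFunLike.congr_fun hg a)
    rwa [MonoidHom.noncommCoprod_apply, map_one, mul_one] at this
  have hN : (wittReduce 3 (ZMod 3)).mapMatrix ((g b).1 - 1) = Y := by
    rw [map_sub, map_one, sub_eq_iff_eq_add', ← hvY, ← hβ]
    have := congrArg Units.val (DFunLike.congr_fun hg b)
    rwa [MonoidHom.noncommCoprod_apply, map_one, one_mul] at this
  have hMN : Commute ((g a).1 - 1) ((g b).1 - 1) :=
    (((hab.map g).units_val).sub_left (Commute.one_left _)).sub_right (Commute.one_right _)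
  obtain ⟨C, D, hC, hD⟩ := h.exists_mul_eq_neg
    (by rw [add_sub_cancel, ← Units.val_pow_eq_pow_val, ← map_pow, ha, map_one, Units.val_one])
    hMN (by rw [hM]; decide) (by rw [hM, hN]; decide)
  rw [hM] at hC hD
  rw [hN] at hD
  have h1 := congrFun (congrFun hC 1) 0
  have h2 := congrFun (congrFun hD 2) 0
  simp [X, Y, Matrix.mul_apply, Fin.sum_univ_three] at h1 h2
  rw [h2] at h1
  revert h1
  decide

end Nonliftable

/-- A finite `3`-group with property `L_3` has order at most three. -/
lemma HasLp.card_eq_one_or_nonempty_mulEquiv {G : Type*} [Group G] [Finite G]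
    (hG : IsPGroup 3 G) (h : HasLp 3 G) :
    Nat.card G = 1 ∨ Nonempty (G ≃* Multiplicative (ZMod 3)) := by
  rw [or_iff_not_imp_left]
  intro h1
  have hnt : Nontrivial G := by
    rw [← not_subsingleton_iff_nontrivial]
    exact fun hs => h1 Nat.card_unique
  have hord (x : G) (hx : x ≠ 1) : orderOf x = 3 := by
    obtain ⟨r, hr⟩ := IsPGroup.iff_orderOf.1 hG x
    obtain _ | _ | r := r
    · exact absurd (orderOf_eq_one_iff.1 hr) hx
    · exact hr
    · refine absurd h (not_hasLp_of_orderOf_eq_nine (x := x ^ 3 ^ r) ?_)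
      rw [orderOf_pow_of_dvd (by positivity) (by rw [hr]; exact pow_dvd_pow _ (by lia)), hr,
        Nat.pow_div (by lia) (by norm_num), show r + 1 + 1 - r = 2 by lia]
  have hc := hG.center_nontrivial
  obtain ⟨⟨z, hz⟩, hz1⟩ := exists_ne (1 : Subgroup.center G)
  have hzo := hord z fun h => hz1 (Subtype.ext h)
  by_cases htop : ∀ w, w ∈ Subgroup.zpowers z
  · have : IsCyclic G := ⟨z, htop⟩
    have hcard : Nat.card G = 3 := by rw [← hzo, orderOf_eq_card_of_forall_mem_zpowers htop]
    refine ⟨mulEquivOfCyclicCardEq ?_⟩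
    rw [hcard]
    exact (Nat.card_zmod 3).symm
  · push Not at htop
    obtain ⟨w, hw⟩ := htop
    have hwo := hord w (fun h => hw (h ▸ one_mem _))
    refine absurd h (not_hasLp_of_commute hzo hwo (Subgroup.mem_center_iff.1 hz w).symm ?_)
    have : Fact (Nat.card (Subgroup.zpowers w)).Prime := ⟨by rw [Nat.card_zpowers, hwo]; norm_num⟩
    rw [disjoint_iff]
    obtain hb | ht := (((Subgroup.zpowers z).subgroupOf (Subgroup.zpowers w))).eq_bot_or_eq_top_of_prime_card
    · exact (Subgroup.subgroupOf_eq_bot.1 hb).eq_bot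
    · exact absurd (Subgroup.subgroupOf_eq_top.1 ht (Subgroup.mem_zpowers w)) hw

section IntegralForm

open Matrix

variable {k V : Type*} [Field k] [AddCommGroup V] [Module k V]

/-- The endomorphism `A` is given, in some basis, by an integral matrix `Z` with `Z ^ d = 1`. -/
def HasIntegralForm (d : ℕ) (A : Module.End k V) : Prop :=
  ∃ (ι : Type) (_ : Fintype ι) (_ : DecidableEq ι) (Z : Matrix ι ι ℤ) (e : V ≃ₗ[k] (ι → k)),
    Z ^ d = 1 ∧ ∀ v, e (A v) = Z.map (Int.castRingHom k) *ᵥ e v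

lemma HasIntegralForm.of_retract {d : ℕ} {A : Module.End k V} {ι : Type} [Fintype ι]
    [DecidableEq ι] {Z : Matrix ι ι ℤ} (hZ : Z ^ d = 1) {π : V →ₗ[k] (ι → k)} {s : (ι → k) →ₗ[k] V}
    (hs : ∀ a, π (s a) = a) (hπA : ∀ v, π (A v) = Z.map (Int.castRingHom k) *ᵥ π v)
    (hsA : ∀ a, A (s a) = s (Z.map (Int.castRingHom k) *ᵥ a))
    (hK : ∀ v ∈ LinearMap.ker π, A v ∈ LinearMap.ker π) (h : HasIntegralForm d (A.restrict hK)) :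
    HasIntegralForm d A := by
  obtain ⟨κ, _, _, Y, e, hY, he⟩ := h
  let E : V ≃ₗ[k] (ι → k) × LinearMap.ker π :=
    { toFun v := (π v, ⟨v - s (π v), by simp [hs]⟩)
      map_add' v w := Prod.ext (map_add π v w) (Subtype.ext (by simp; abel))
      map_smul' c v := Prod.ext (map_smul π c v) (Subtype.ext (by simp [smul_sub]))
      invFun a := s a.1 + a.2
      left_inv v := by simp
      right_inv a := by
        have := LinearMap.mem_ker.1 a.2.2
        refine Prod.ext ?_ (Subtype.ext ?_) <;> simp [hs, this] }
  refine ⟨ι ⊕ κ, inferInstance, inferInstance, Matrix.fromBlocks Z 0 0 Y,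
    E ≪≫ₗ (LinearEquiv.refl k _).prodCongr e ≪≫ₗ
      (LinearEquiv.sumArrowLequivProdArrow ι κ k k).symm, ?_, fun v => ?_⟩
  · rw [Matrix.fromBlocks_diagonal_pow, hZ, hY, Matrix.fromBlocks_one]
  · have hE : E (A v) = (Z.map (Int.castRingHom k) *ᵥ π v, A.restrict hK (E v).2) :=
      Prod.ext (hπA v) (Subtype.ext (by simp [E, hπA, hsA]))
    have hmap : (Matrix.fromBlocks Z 0 0 Y).map (Int.castRingHom k) =
        Matrix.fromBlocks (Z.map (Int.castRingHom k)) 0 0 (Y.map (Int.castRingHom k)) := by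
      rw [Matrix.fromBlocks_map, Matrix.map_zero _ (map_zero _), Matrix.map_zero _ (map_zero _)]
    rw [hmap, Matrix.fromBlocks_mulVec]
    simp only [LinearEquiv.trans_apply, hE, LinearEquiv.prodCongr_apply, he]
    ext (i | i)
    · simp [E, Function.comp_def]
    · simp [E, Function.comp_def]

lemma hasIntegralForm_one [FiniteDimensional k V] (d : ℕ) :
    HasIntegralForm d (1 : Module.End k V) :=
  ⟨Fin (Module.finrank k V), inferInstance, inferInstance, 1, (Module.finBasis k V).equivFun,
    one_pow d, fun v => by simp⟩

/-- Over a field of characteristic `3`, every endomorphism of order dividing `3` is given in a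
suitable basis by an integral matrix of order dividing `3`. -/
theorem hasIntegralForm_three [CharP k 3] [FiniteDimensional k V] (A : Module.End k V)
    (hA : ∀ v, A (A (A v)) = v) : HasIntegralForm 3 A := by
  induction hn : Module.finrank k V using Nat.strong_induction_on generalizing V with
  | _ n ih =>
  have h3 : (3 : k) = 0 := by exact_mod_cast CharP.cast_eq_zero k 3
  have step {ι : Type} [Fintype ι] [DecidableEq ι] [Nonempty ι] {Z : Matrix ι ι ℤ} (hZ : Z ^ 3 = 1)
      (π : V →ₗ[k] (ι → k)) (s : (ι → k) →ₗ[k] V)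
      (hs : ∀ a, π (s a) = a) (hπA : ∀ v, π (A v) = Z.map (Int.castRingHom k) *ᵥ π v)
      (hsA : ∀ a, A (s a) = s (Z.map (Int.castRingHom k) *ᵥ a)) : HasIntegralForm 3 A := by
    have hK : ∀ v ∈ LinearMap.ker π, A v ∈ LinearMap.ker π := fun v hv => by
      rw [LinearMap.mem_ker] at hv ⊢
      rw [hπA, hv, Matrix.mulVec_zero]
    refine .of_retract hZ hs hπA hsA hK (ih _ ?_ _ (fun v => Subtype.ext (hA v)) rfl)
    rw [← hn]
    refine Submodule.finrank_lt fun htop => ?_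
    have := hs 1
    rw [LinearMap.ker_eq_top.1 htop] at this
    exact zero_ne_one this
  have hdual {w : V} (hw : w ≠ 0) : ∃ ξ : Module.Dual k V, ξ w = 1 := by
    obtain ⟨ξ, hξ⟩ := not_forall.1 (mt (Module.forall_dual_apply_eq_zero_iff k w).1 hw)
    exact ⟨(ξ w)⁻¹ • ξ, inv_mul_cancel₀ hξ⟩
  by_cases h1 : ∃ v, v + A v + A (A v) ≠ 0
  · obtain ⟨v, hv⟩ := h1
    obtain ⟨ξ, hξ⟩ := hdual hv
    simp only [map_add] at hξ
    obtain ⟨u, hu0, hu1, hu2⟩ : ∃ u, ξ u = 0 ∧ ξ (A u) = 0 ∧ ξ (A (A u)) = 1 := by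
      generalize ha : ξ v = a at *
      generalize hb : ξ (A v) = b at *
      generalize hc : ξ (A (A v)) = c at *
      refine ⟨(1 + (b - a) + (b - a) ^ 2 - a) • v + (-(b - a) + (b - a) ^ 2 - a) • A v +
        ((b - a) ^ 2 - a) • A (A v), ?_, ?_, ?_⟩ <;>
        simp only [map_add, map_smul, smul_eq_mul, hA, ha, hb, hc]
      · linear_combination ((b - a) ^ 2 - a) * hξ
      · linear_combination ((b - a) ^ 2 - a - (b - a)) * hξ + (b - a) * b * h3
      · linear_combination ((b - a) ^ 2 - a + (b - a) + 1) * hξ - ((b - a) + 1) * a * h3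
    have hZ : !![0, 1, 0; 0, 0, 1; 1, 0, (0 : ℤ)] ^ 3 = 1 := by decide
    refine step hZ (LinearMap.pi ![ξ, ξ ∘ₗ A, ξ ∘ₗ A ∘ₗ A])
      (Fintype.linearCombination k ![A (A u), A u, u]) (fun a => ?_) (fun v => ?_) fun a => ?_
    · ext i
      fin_cases i <;>
        simp [Fintype.linearCombination_apply, Fin.sum_univ_three, hA, hu0, hu1, hu2]
    · ext i
      fin_cases i <;> simp [Matrix.mulVec, dotProduct, Fin.sum_univ_three, hA]
    · simp [Matrix.mulVec, dotProduct, Fintype.linearCombination_apply, Fin.sum_univ_three, hA]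
      abel
  · push Not at h1
    by_cases h2 : ∃ v, A v - v ≠ 0
    · obtain ⟨v, hv⟩ := h2
      have hAA (v : V) : A (A v) = -v - A v := by
        rw [← sub_eq_zero, ← h1 v]
        abel
      obtain ⟨ξ, hξ⟩ := hdual hv
      rw [map_sub] at hξ
      obtain ⟨u, hu0, hu1⟩ : ∃ u, ξ u = 0 ∧ ξ (A u) = 1 := by
        refine ⟨v - ξ v • (A v - v), ?_, ?_⟩ <;>
          simp only [map_sub, map_smul, smul_eq_mul, hAA, map_neg]
        · linear_combination -ξ v * hξ
        · linear_combination (1 + 2 * ξ v) * hξ + (ξ v ^ 2 + ξ v) * h3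
      have hZ : !![0, 1; -1, (-1 : ℤ)] ^ 3 = 1 := by decide
      refine step hZ (LinearMap.pi ![ξ, ξ ∘ₗ A])
        (Fintype.linearCombination k ![A u + u, u]) (fun a => ?_) (fun v => ?_) fun a => ?_
      · ext i
        fin_cases i <;>
          simp [Fintype.linearCombination_apply, Fin.sum_univ_two, hAA, hu0, hu1]
      · ext i
        fin_cases i <;> simp [Matrix.mulVec, dotProduct, Fin.sum_univ_two, hAA]
        ring
      · simp [Fintype.linearCombination_apply, Fin.sum_univ_two, hAA]
        module
    · push Not at h2
      have : A = 1 := LinearMap.ext fun v => sub_eq_zero.1 (h2 v)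
      exact this ▸ hasIntegralForm_one 3

end IntegralForm

lemma hasLp_three_of_mulEquiv {G : Type*} [Group G] (φ : G ≃* Multiplicative (ZMod 3)) :
    HasLp 3 G := by
  intro n _ k _ _ _ f
  have hcyc : IsCyclic G := isCyclic_of_surjective φ.symm φ.symm.surjective
  obtain ⟨x, hx⟩ := hcyc.exists_generator
  have hcard : Nat.card G = 3 := (Nat.card_congr φ.toEquiv).trans (Nat.card_zmod 3)
  have hord : orderOf x = 3 := (orderOf_eq_card_of_forall_mem_zpowers hx).trans hcard
  have hA : (f x).1 ^ 3 = 1 := by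
    rw [← Units.val_pow_eq_pow_val, ← map_pow, ← hord, pow_orderOf_eq_one, map_one, Units.val_one]
  obtain ⟨ι, _, _, Z, e, hZ, he⟩ := hasIntegralForm_three (Matrix.toLin' (f x).1) fun v => by
    simp only [Matrix.toLin'_apply, Matrix.mulVec_mulVec]
    rw [← mul_assoc, ← pow_three', hA, Matrix.one_mulVec]
  obtain ⟨B, hB, hBA⟩ := (isLengthTwo_wittReduce 3 k).exists_pow_eq_one_map_eq
    (A := (f x).1) (Z := Z.map (Int.castRingHom _)) (d := 3)
    (P₀ := LinearMap.toMatrix' e.symm.toLinearMap) (I₀ := LinearMap.toMatrix' e.toLinearMap)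
    (by
      rw [← RingHom.mapMatrix_apply, ← map_pow, hZ, map_one])
    (by rw [← LinearMap.toMatrix'_comp, LinearEquiv.symm_comp, LinearMap.toMatrix'_id])
    (by rw [← LinearMap.toMatrix'_comp, LinearEquiv.comp_symm, LinearMap.toMatrix'_id])
    (by
      apply Matrix.toLin'.injective
      refine LinearMap.ext fun v => ?_
      rw [Matrix.toLin'_mul, Matrix.toLin'_mul, Matrix.toLin'_toMatrix', Matrix.toLin'_toMatrix',
        Matrix.map_map, ← RingHom.coe_comp, Subsingleton.elim (RingHom.comp _ _) (Int.castRingHom k)]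
      change e.symm (Matrix.mulVec _ (e v)) = _
      rw [← he, e.symm_apply_apply])
  let u : GL (Fin n) (TruncatedWittVector 3 2 k) := Units.ofPowEqOne B 3 hB (by norm_num)
  have hu : orderOf u ∣ orderOf x := by
    rw [hord]
    exact orderOf_dvd_of_pow_eq_one (Units.pow_ofPowEqOne hB _)
  refine ⟨monoidHomOfForallMemZpowers hx hu, ?_⟩
  rw [MonoidHom.eq_iff_eq_on_generator hx, MonoidHom.comp_apply,
    monoidHomOfForallMemZpowers_apply_gen]
  exact Units.ext hBA

lemma hasLp_of_subsingleton (p : ℕ) [Fact p.Prime] (G : Type*) [Group G] [Subsingleton G] :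
    HasLp p G := by
  intro n _ k _ _ _ f
  refine ⟨1, MonoidHom.ext fun x => ?_⟩
  rw [Subsingleton.elim x 1, map_one, map_one]

/-- for `p > 3`, a finite `p`-group has property `L_p` iff it is trivial;
for `p = 3`, a finite `3`-group has property `L_3` iff it is trivial or `ℤ/3ℤ`. -/
theorem p_group_hasLp_classification (p : ℕ) [Fact p.Prime] (G : Type*) [Group G] [Finite G]
    (hG : IsPGroup p G) :
    (3 < p → (HasLp p G ↔ Nat.card G = 1)) ∧
    (p = 3 → (HasLp p G ↔ (Nat.card G = 1 ∨ Nonempty (G ≃* Multiplicative (ZMod 3))))) := by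
  have htriv (h : Nat.card G = 1) : HasLp p G := by
    have := (Nat.card_eq_one_iff_unique.1 h).1
    exact hasLp_of_subsingleton p G
  refine ⟨fun hp => ⟨fun h => ?_, htriv⟩, ?_⟩
  · by_contra h1
    have : Nontrivial G := by
      rw [← not_subsingleton_iff_nontrivial]
      exact fun hs => h1 Nat.card_unique
    obtain ⟨r, hr, hcard⟩ := hG.nontrivial_iff_card.1 this
    obtain ⟨x, hx⟩ := exists_prime_orderOf_dvd_card' (G := G) p
      (hcard ▸ dvd_pow_self p hr.ne')
    exact not_hasLp_of_three_lt hp hx h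
  · rintro rfl
    refine ⟨HasLp.card_eq_one_or_nonempty_mulEquiv hG, ?_⟩
    rintro (h | ⟨⟨φ⟩⟩)
    · exact htriv h
    · exact hasLp_three_of_mulEquiv φ
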